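/- Let X ⊂ ℂⁿ be a domain whose Bergman pseudodistance d^b_X is a distance. Then the Bergman–Fridman invariant function h_X : X → [0,∞) is continuous on X. -/

import Mathlib

open MeasureTheory Metric Filter Topology Set
open scoped ENNReal

noncomputable section

/-- Membership in the Bergman space `A²(Ω)`: holomorphic and square-integrable. -/
def MemA2 {n : ℕ} (Ω : Set (Fin n → ℂ)) (f : (Fin n → ℂ) → ℂ) : Prop :=
  DifferentiableOn ℂ f Ω ∧ MemLp f 2 (volume.restrict Ω)

/-- `K` is the Bergman kernel of `Ω`: the reproducing kernel of `A²(Ω)`. -/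
def IsBergmanKernel {n : ℕ} (Ω : Set (Fin n → ℂ)) (K : (Fin n → ℂ) → (Fin n → ℂ) → ℂ) : Prop :=
  (∀ w ∈ Ω, MemA2 Ω fun z => K z w) ∧
  ∀ f, MemA2 Ω f → ∀ w ∈ Ω, f w = ∫ z in Ω, f z * (starRingEnd ℂ) (K z w)

/-- Wirtinger derivative `∂f/∂z_μ`. -/
def wderiv {n : ℕ} (μ : Fin n) (f : (Fin n → ℂ) → ℂ) (z : Fin n → ℂ) : ℂ :=
  (fderiv ℝ f z (Pi.single μ 1) - Complex.I * fderiv ℝ f z (Pi.single μ Complex.I)) / 2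

/-- Wirtinger derivative `∂f/∂z̄_μ`. -/
def wderivBar {n : ℕ} (μ : Fin n) (f : (Fin n → ℂ) → ℂ) (z : Fin n → ℂ) : ℂ :=
  (fderiv ℝ f z (Pi.single μ 1) + Complex.I * fderiv ℝ f z (Pi.single μ Complex.I)) / 2

/-- One-variable Wirtinger derivative `∂f/∂z`. -/
def wderiv1 (f : ℂ → ℂ) (z : ℂ) : ℂ :=
  (fderiv ℝ f z 1 - Complex.I * fderiv ℝ f z Complex.I) / 2

/-- One-variable Wirtinger derivative `∂f/∂z̄`. -/
def wderiv1Bar (f : ℂ → ℂ) (z : ℂ) : ℂ :=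
  (fderiv ℝ f z 1 + Complex.I * fderiv ℝ f z Complex.I) / 2

/-- Bergman metric tensor `g_{μν}(z) = ∂² log K(z,z) / ∂z_μ ∂z̄_ν`. -/
def bergmanTensor {n : ℕ} (K : (Fin n → ℂ) → (Fin n → ℂ) → ℂ) (μ ν : Fin n)
    (z : Fin n → ℂ) : ℂ :=
  wderiv μ (fun w => wderivBar ν (fun u => Complex.log (K u u)) w) z

/-- The hermitian quadratic form of the Bergman metric. -/
def bergmanQuad {n : ℕ} (K : (Fin n → ℂ) → (Fin n → ℂ) → ℂ) (z ξ : Fin n → ℂ) : ℝ :=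
  (∑ μ, ∑ ν, bergmanTensor K μ ν z * ξ μ * (starRingEnd ℂ) (ξ ν)).re

/-- The Bergman metric `b_Ω(z,ξ)`. -/
def bergmanMetric {n : ℕ} (K : (Fin n → ℂ) → (Fin n → ℂ) → ℂ) (z ξ : Fin n → ℂ) : ℝ :=
  Real.sqrt (bergmanQuad K z ξ)

/-- Piecewise-`C¹` curves on `[0,1]`. -/
def PiecewiseC1 {n : ℕ} (γ : ℝ → (Fin n → ℂ)) : Prop :=
  ContinuousOn γ (Set.Icc 0 1) ∧
  ∃ (k : ℕ) (t : Fin (k + 1) → ℝ), StrictMono t ∧ t 0 = 0 ∧ t (Fin.last k) = 1 ∧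
    ∀ i : Fin k, ContDiffOn ℝ 1 γ (Set.Icc (t i.castSucc) (t i.succ))

/-- The Bergman length of a curve. -/
def bergmanLength {n : ℕ} (K : (Fin n → ℂ) → (Fin n → ℂ) → ℂ) (γ : ℝ → (Fin n → ℂ)) : ℝ :=
  ∫ t in (0:ℝ)..1, bergmanMetric K (γ t) (deriv γ t)

/-- The Bergman pseudodistance of `Ω`. -/
def bergmanDist {n : ℕ} (Ω : Set (Fin n → ℂ)) (K : (Fin n → ℂ) → (Fin n → ℂ) → ℂ)
    (z w : Fin n → ℂ) : ℝ :=
  sInf { L : ℝ | ∃ γ : ℝ → (Fin n → ℂ), γ 0 = z ∧ γ 1 = w ∧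
    (∀ t ∈ Set.Icc (0:ℝ) 1, γ t ∈ Ω) ∧ PiecewiseC1 γ ∧ L = bergmanLength K γ }

/-- The Bergman ball `B_Ω(p,r)`. -/
def bergmanBall {n : ℕ} (Ω : Set (Fin n → ℂ)) (K : (Fin n → ℂ) → (Fin n → ℂ) → ℂ)
    (p : Fin n → ℂ) (r : ℝ) : Set (Fin n → ℂ) :=
  { z ∈ Ω | bergmanDist Ω K p z < r }

/-- The Bergman pseudodistance is an honest distance. -/
def BergmanDistIsDistance {n : ℕ} (Ω : Set (Fin n → ℂ))
    (K : (Fin n → ℂ) → (Fin n → ℂ) → ℂ) : Prop :=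
  ∀ z ∈ Ω, ∀ w ∈ Ω, z ≠ w → 0 < bergmanDist Ω K z w

/-- `Ω` is complete with respect to the Bergman distance. -/
def BergmanComplete {n : ℕ} (Ω : Set (Fin n → ℂ))
    (K : (Fin n → ℂ) → (Fin n → ℂ) → ℂ) : Prop :=
  ∀ x : ℕ → (Fin n → ℂ), (∀ k, x k ∈ Ω) →
    (∀ ε : ℝ, 0 < ε → ∃ N, ∀ k ≥ N, ∀ l ≥ N, bergmanDist Ω K (x k) (x l) < ε) →
    ∃ p ∈ Ω, Filter.Tendsto (fun k => bergmanDist Ω K (x k) p) Filter.atTop (nhds 0)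

/-- The Euclidean unit ball `𝔹ⁿ ⊂ ℂⁿ`. -/
def euclUnitBall (n : ℕ) : Set (Fin n → ℂ) :=
  { z | ∑ μ, ‖z μ‖ ^ 2 < 1 }

/-- The Bergman–Fridman invariant `h_X(p)`. -/
def fridmanInv {n : ℕ} (Ω : Set (Fin n → ℂ)) (K : (Fin n → ℂ) → (Fin n → ℂ) → ℂ)
    (p : Fin n → ℂ) : ℝ :=
  sInf { c : ℝ | ∃ r : ℝ, 0 < r ∧ c = 1 / r ∧ ∃ f : (Fin n → ℂ) → (Fin n → ℂ),
    DifferentiableOn ℂ f (euclUnitBall n) ∧ Set.InjOn f (euclUnitBall n) ∧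
    f '' euclUnitBall n ⊆ Ω ∧ bergmanBall Ω K p r ⊆ f '' euclUnitBall n }

/-- Biholomorphic equivalence of domains in `ℂⁿ` (an injective holomorphic map of `ℂⁿ`
restricted to a domain is automatically a biholomorphism onto its image). -/
def Biholomorphic {n : ℕ} (U V : Set (Fin n → ℂ)) : Prop :=
  ∃ f : (Fin n → ℂ) → (Fin n → ℂ),
    DifferentiableOn ℂ f U ∧ Set.InjOn f U ∧ f '' U = V

/-- The Levi form of a real-valued function `ρ` at `p` in direction `ξ`. -/
def leviForm {n : ℕ} (ρ : (Fin n → ℂ) → ℝ) (p ξ : Fin n → ℂ) : ℝ :=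
  (∑ μ, ∑ ν, wderiv μ (fun w => wderivBar ν (fun u => (ρ u : ℂ)) w) p
      * ξ μ * (starRingEnd ℂ) (ξ ν)).re

/-- The complex tangent space of `{ρ = 0}` at `p`. -/
def complexTangent {n : ℕ} (ρ : (Fin n → ℂ) → ℝ) (p : Fin n → ℂ) : Set (Fin n → ℂ) :=
  { ξ | ∑ μ, wderiv μ (fun u => (ρ u : ℂ)) p * ξ μ = 0 }

/-- Strong pseudoconvexity at a boundary point, for defining function `ρ`. -/
def StronglyPseudoconvexAt {n : ℕ} (ρ : (Fin n → ℂ) → ℝ) (p : Fin n → ℂ) : Prop :=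
  ∀ ξ ∈ complexTangent ρ p, ξ ≠ 0 → 0 < leviForm ρ p ξ

/-- `ρ` is a (global) defining function for `D`. -/
def IsDefiningFunction {n : ℕ} (D : Set (Fin n → ℂ)) (ρ : (Fin n → ℂ) → ℝ) : Prop :=
  (∀ z, z ∈ D ↔ ρ z < 0) ∧ ∀ z ∈ frontier D, fderiv ℝ ρ z ≠ 0

/-- Plurisubharmonicity via the sub-mean-value property on complex lines. -/
def PlurisubharmonicOn {n : ℕ} (u : (Fin n → ℂ) → ℝ) (Ω : Set (Fin n → ℂ)) : Prop :=
  UpperSemicontinuousOn u Ω ∧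
  ∀ (a b : Fin n → ℂ) (r : ℝ), 0 < r →
    (∀ w : ℂ, ‖w‖ ≤ r → a + w • b ∈ Ω) →
    u a ≤ (1 / (2 * Real.pi)) *
      ∫ θ in (0:ℝ)..(2 * Real.pi), u (a + ((r : ℂ) * Complex.exp (θ * Complex.I)) • b)

/-- Pseudoconvexity: `-log dist(·, ∂D)` is plurisubharmonic on `D`. -/
def IsPseudoconvex {n : ℕ} (D : Set (Fin n → ℂ)) : Prop :=
  PlurisubharmonicOn (fun z => -Real.log (Metric.infDist z Dᶜ)) D

/-- Order of vanishing at `0` of a vector-valued map on `ℂ` (`⊤` if it vanishes to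
infinite order). -/
def vanishingOrderC {n : ℕ} (f : ℂ → (Fin n → ℂ)) : ℝ≥0∞ :=
  sInf ((fun m : ℕ => (m : ℝ≥0∞)) '' { m : ℕ | iteratedDeriv m f 0 ≠ 0 })

/-- Order of vanishing at `0` of a real-valued function on `ℂ`. -/
def vanishingOrderR (g : ℂ → ℝ) : ℝ≥0∞ :=
  sInf ((fun m : ℕ => (m : ℝ≥0∞)) '' { m : ℕ | iteratedFDeriv ℝ m g 0 ≠ 0 })

/-- The D'Angelo 1-type of `ρ` at `p`. -/
def dAngeloOneType {n : ℕ} (ρ : (Fin n → ℂ) → ℝ) (p : Fin n → ℂ) : ℝ≥0∞ :=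
  ⨆ (φ : ℂ → (Fin n → ℂ)) (_ : AnalyticAt ℂ φ 0) (_ : φ 0 = p)
    (_ : vanishingOrderC (fun w => φ w - p) ≠ ⊤),
    vanishingOrderR (fun w => ρ (φ w)) / vanishingOrderC (fun w => φ w - p)

/-- The Levi form at `p` has at most one degenerate eigenvalue. -/
def LeviCorankOneAt {n : ℕ} (ρ : (Fin n → ℂ) → ℝ) (p : Fin n → ℂ) : Prop :=
  ∃ V : Submodule ℂ (Fin n → ℂ), n - 2 ≤ Module.finrank ℂ V ∧
    (V : Set (Fin n → ℂ)) ⊆ complexTangent ρ p ∧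
    ∀ ξ ∈ V, ξ ≠ 0 → 0 < leviForm ρ p ξ

/-- A bounded smooth pseudoconvex finite-type Levi corank one domain, with defining
function `ρ`. -/
def IsLeviCorankOneDomain {n : ℕ} (D : Set (Fin n → ℂ)) (ρ : (Fin n → ℂ) → ℝ) : Prop :=
  IsOpen D ∧ IsConnected D ∧ Bornology.IsBounded D ∧ IsPseudoconvex D ∧
  ContDiff ℝ (⊤ : ℕ∞) ρ ∧ IsDefiningFunction D ρ ∧
  (∀ p ∈ frontier D, dAngeloOneType ρ p ≠ ⊤) ∧
  ∀ p ∈ frontier D, LeviCorankOneAt ρ p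

/-- The open unit disc in `ℂ`. -/
def openUnitDisc : Set ℂ := Metric.ball 0 1

/-- Tautness of a domain in `ℂⁿ`. -/
def IsTaut {n : ℕ} (D : Set (Fin n → ℂ)) : Prop :=
  ∀ f : ℕ → ℂ → (Fin n → ℂ),
    (∀ k, DifferentiableOn ℂ (f k) openUnitDisc ∧ f k '' openUnitDisc ⊆ D) →
    ∃ φ : ℕ → ℕ, StrictMono φ ∧
      ((∃ g : ℂ → (Fin n → ℂ), DifferentiableOn ℂ g openUnitDisc ∧ g '' openUnitDisc ⊆ D ∧
          TendstoLocallyUniformlyOn (fun k => f (φ k)) g Filter.atTop openUnitDisc) ∨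
        ∀ S : Set ℂ, IsCompact S → S ⊆ openUnitDisc →
          ∀ L : Set (Fin n → ℂ), IsCompact L → L ⊆ D →
            ∀ᶠ k in Filter.atTop, ∀ w ∈ S, f (φ k) w ∉ L)

/-- Convergence of a sequence of domains in the local Hausdorff sense. -/
def LocalHausdorffConv {n : ℕ} (Ω : ℕ → Set (Fin n → ℂ)) (Ωl : Set (Fin n → ℂ)) : Prop :=
  (∀ S : Set (Fin n → ℂ), IsCompact S → S ⊆ Ωl → ∀ᶠ j in Filter.atTop, S ⊆ Ω j) ∧
  ∀ S : Set (Fin n → ℂ), IsCompact S →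
    (∃ j₀ : ℕ, S ⊆ interior (⋂ j, ⋂ (_ : j₀ ≤ j), Ω j)) → S ⊆ Ωl

/-- A real-valued subharmonic polynomial of degree at most `d` in one complex variable,
containing no harmonic terms. -/
def SubharmonicPolyNoHarm (P : ℂ → ℝ) (d : ℕ) : Prop :=
  (∃ c : Fin (d + 1) → Fin (d + 1) → ℂ,
    (∀ j, c j 0 = 0) ∧ (∀ k, c 0 k = 0) ∧
    ∀ w : ℂ, (P w : ℂ) = ∑ j, ∑ k, c j k * w ^ (j : ℕ) * (starRingEnd ℂ) w ^ (k : ℕ)) ∧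
  ∀ w : ℂ, 0 ≤ (wderiv1 (fun u => wderiv1Bar (fun v => (P v : ℂ)) u) w).re

/-- A strictly subharmonic real polynomial of degree `2` in one complex variable. -/
def StrictlySubharmonicPolyDeg2 (Q : ℂ → ℝ) : Prop :=
  (∃ c : Fin 3 → Fin 3 → ℂ, ∀ w : ℂ,
      (Q w : ℂ) = ∑ j, ∑ k, c j k * w ^ (j : ℕ) * (starRingEnd ℂ) w ^ (k : ℕ)) ∧
  ∀ w : ℂ, 0 < (wderiv1 (fun u => wderiv1Bar (fun v => (Q v : ℂ)) u) w).re

/-- A nontangential cone in `D` with vertex `p0 ∈ ∂D`. -/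
def IsNontangentialCone {n : ℕ} (D Γ : Set (Fin n → ℂ)) (p0 : Fin n → ℂ) : Prop :=
  Γ ⊆ D ∧ p0 ∈ closure Γ ∧
  ∃ C : ℝ, 0 < C ∧ ∀ z ∈ Γ, ‖z - p0‖ ≤ C * Metric.infDist z Dᶜ

/-- The Bergman kernel is positive on the diagonal of `Ω`. -/
def DiagPos {n : ℕ} (Ω : Set (Fin n → ℂ)) (K : (Fin n → ℂ) → (Fin n → ℂ) → ℂ) : Prop :=
  ∀ z ∈ Ω, (K z z).im = 0 ∧ 0 < (K z z).re

/-- The Bergman metric of `Ω` is positive definite. -/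
def BergPosDef {n : ℕ} (Ω : Set (Fin n → ℂ)) (K : (Fin n → ℂ) → (Fin n → ℂ) → ℂ) : Prop :=
  ∀ z ∈ Ω, ∀ ξ : Fin n → ℂ, ξ ≠ 0 → 0 < bergmanMetric K z ξ

/-- The real coordinate directions of `ℂⁿ ≃ ℝ^{2n}`. -/
def realDir {n : ℕ} (μ : Fin (2 * n)) : Fin n → ℂ :=
  Pi.single ⟨(μ : ℕ) / 2, by have := μ.isLt; omega⟩
    (if (μ : ℕ) % 2 = 0 then 1 else Complex.I)

/-- The real coefficients `g̃_{μν}` of the Bergman metric, obtained by polarization. -/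
def realTensor {n : ℕ} (K : (Fin n → ℂ) → (Fin n → ℂ) → ℂ) (μ ν : Fin (2 * n))
    (z : Fin n → ℂ) : ℝ :=
  (bergmanQuad K z (realDir μ + realDir ν) - bergmanQuad K z (realDir μ)
    - bergmanQuad K z (realDir ν)) / 2

/-- The Christoffel symbols `Γ^η_{μν}` of the Bergman metric, in real coordinates. -/
def christoffel {n : ℕ} (K : (Fin n → ℂ) → (Fin n → ℂ) → ℂ) (η μ ν : Fin (2 * n))
    (z : Fin n → ℂ) : ℝ :=
  (1 / 2) * ∑ τ : Fin (2 * n),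
    (fderiv ℝ (realTensor K ν τ) z (realDir μ)
      + fderiv ℝ (realTensor K τ μ) z (realDir ν)
      - fderiv ℝ (realTensor K μ ν) z (realDir τ))
    * (Matrix.of fun a b => realTensor K a b z)⁻¹ τ η

/-- `z0 ∈ ∂D` is a local holomorphic peak point of `D`. -/
def IsLocalPeakPoint {n : ℕ} (D : Set (Fin n → ℂ)) (z0 : Fin n → ℂ) : Prop :=
  ∃ U ∈ nhds z0, ∃ g : (Fin n → ℂ) → ℂ,
    DifferentiableOn ℂ g (U ∩ D) ∧ ContinuousOn g (closure (U ∩ D)) ∧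
    g z0 = 1 ∧ ∀ z ∈ closure (U ∩ D), z ≠ z0 → ‖g z‖ < 1

/-- A real polynomial on `ℂⁿ` containing no pluriharmonic terms. -/
def IsPolyNoPluriharm {n : ℕ} (P : (Fin n → ℂ) → ℝ) : Prop :=
  ∃ (d : ℕ) (c : (Fin n → Fin (d + 1)) → (Fin n → Fin (d + 1)) → ℂ),
    (∀ α β, (∀ j, (β j : ℕ) = 0) → c α β = 0) ∧
    (∀ α β, (∀ j, (α j : ℕ) = 0) → c α β = 0) ∧
    ∀ z, (P z : ℂ) = ∑ α, ∑ β, c α β * (∏ j, z j ^ (α j : ℕ)) *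
      ∏ j, (starRingEnd ℂ) (z j) ^ (β j : ℕ)


theorem piecewiseC1_iff {n : ℕ} (γ : ℝ → (Fin n → ℂ)) :
    PiecewiseC1 γ ↔ ContinuousOn γ (Icc 0 1) ∧ ∃ F : Finset ℝ, ∀ a b : ℝ, 0 ≤ a → a < b → b ≤ 1 →
      (∀ x ∈ F, x ∉ Ioo a b) → ContDiffOn ℝ 1 γ (Icc a b) := by
  refine and_congr_right fun _ => ⟨?_, ?_⟩
  · rintro ⟨k, t, ht, h0, h1, hd⟩
    refine ⟨Finset.univ.image t, fun a b ha hab hb hF => ?_⟩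
    obtain ⟨i, hi, hmax⟩ := (Finset.univ.filter fun i => t i ≤ a).exists_max_image id
      ⟨0, by simpa [h0] using ha⟩
    simp only [Finset.mem_filter, Finset.mem_univ, true_and, id] at hi hmax
    induction i using Fin.lastCases with
    | last => linarith
    | cast j =>
      refine (hd j).mono (Icc_subset_Icc hi ?_)
      by_contra! hlt
      refine hF _ (Finset.mem_image_of_mem t (Finset.mem_univ j.succ)) ⟨?_, hlt⟩
      by_contra! hle
      exact absurd (hmax _ hle) (not_le.2 j.castSucc_lt_succ)
  · rintro ⟨F, hF⟩
    set G : Finset ℝ := insert 0 (insert 1 (F.filter (· ∈ Icc (0 : ℝ) 1))) with hG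
    have hG01 : ∀ x ∈ G, x ∈ Icc (0 : ℝ) 1 := by
      intro x hx
      simp only [hG, Finset.mem_insert, Finset.mem_filter] at hx
      rcases hx with rfl | rfl | hx
      · simp
      · simp
      · exact hx.2
    have h0G : (0 : ℝ) ∈ G := by simp [hG]
    have h1G : (1 : ℝ) ∈ G := by simp [hG]
    obtain ⟨k, hk⟩ : ∃ k, G.card = k + 1 :=
      ⟨G.card - 1, (Nat.sub_add_cancel (Finset.card_pos.2 ⟨0, h0G⟩)).symm⟩
    have hmem : ∀ i, G.orderEmbOfFin hk i ∈ G := fun i => G.orderEmbOfFin_mem hk i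
    have hsurj : ∀ x ∈ G, ∃ i, G.orderEmbOfFin hk i = x := fun x hx => by
      have : x ∈ range (G.orderEmbOfFin hk) := by rw [Finset.range_orderEmbOfFin]; exact hx
      exact this
    have hmono := (G.orderEmbOfFin hk).strictMono
    refine ⟨k, G.orderEmbOfFin hk, hmono, ?_, ?_, fun i => ?_⟩
    · obtain ⟨i, hi⟩ := hsurj 0 h0G
      refine le_antisymm ?_ (hG01 _ (hmem _)).1
      rw [← hi]
      exact hmono.monotone (Fin.zero_le i)
    · obtain ⟨i, hi⟩ := hsurj 1 h1G
      refine le_antisymm (hG01 _ (hmem _)).2 ?_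
      rw [← hi]
      exact hmono.monotone (Fin.le_last i)
    · refine hF _ _ (hG01 _ (hmem _)).1 (hmono i.castSucc_lt_succ) (hG01 _ (hmem _)).2 ?_
      intro x hx hxI
      have hxG : x ∈ G := by
        simp only [hG, Finset.mem_insert, Finset.mem_filter]
        exact .inr (.inr ⟨hx, (hG01 _ (hmem _)).1.trans hxI.1.le,
          hxI.2.le.trans (hG01 _ (hmem _)).2⟩)
      obtain ⟨j, rfl⟩ := hsurj x hxG
      have h1 := hmono.lt_iff_lt.1 hxI.1
      have h2 := hmono.lt_iff_lt.1 hxI.2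
      simp only [Fin.lt_def, Fin.val_castSucc, Fin.val_succ] at h1 h2
      omega

theorem bergmanMetric_nonneg {n : ℕ} (K : (Fin n → ℂ) → (Fin n → ℂ) → ℂ) (z ξ : Fin n → ℂ) :
    0 ≤ bergmanMetric K z ξ := Real.sqrt_nonneg _

theorem bergmanMetric_smul {n : ℕ} (K : (Fin n → ℂ) → (Fin n → ℂ) → ℂ) (z ξ : Fin n → ℂ)
    (c : ℝ) : bergmanMetric K z (c • ξ) = |c| * bergmanMetric K z ξ := by
  have : bergmanQuad K z (c • ξ) = c ^ 2 * bergmanQuad K z ξ := by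
    unfold bergmanQuad
    rw [← Complex.re_ofReal_mul, Finset.mul_sum]
    refine congrArg Complex.re (Finset.sum_congr rfl fun μ _ => ?_)
    rw [Finset.mul_sum]
    refine Finset.sum_congr rfl fun ν _ => ?_
    simp only [Pi.smul_apply, Complex.real_smul, map_mul, Complex.conj_ofReal]
    push_cast
    ring
  rw [bergmanMetric, this, Real.sqrt_mul (sq_nonneg c), Real.sqrt_sq_eq_abs, bergmanMetric]

theorem bergmanLength_nonneg {n : ℕ} (K : (Fin n → ℂ) → (Fin n → ℂ) → ℂ)
    (γ : ℝ → (Fin n → ℂ)) : 0 ≤ bergmanLength K γ :=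
  intervalIntegral.integral_nonneg zero_le_one fun _ _ => bergmanMetric_nonneg ..

theorem bergmanDist_nonneg {n : ℕ} (X : Set (Fin n → ℂ)) (K : (Fin n → ℂ) → (Fin n → ℂ) → ℂ)
    (z w : Fin n → ℂ) : 0 ≤ bergmanDist X K z w := by
  refine Real.sInf_nonneg ?_
  rintro _ ⟨γ, -, -, -, -, rfl⟩
  exact bergmanLength_nonneg K γ

theorem bergmanDist_le_length {n : ℕ} {X : Set (Fin n → ℂ)} {K : (Fin n → ℂ) → (Fin n → ℂ) → ℂ}
    {γ : ℝ → (Fin n → ℂ)} (hγ : PiecewiseC1 γ) (hX : ∀ t ∈ Icc (0 : ℝ) 1, γ t ∈ X) :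
    bergmanDist X K (γ 0) (γ 1) ≤ bergmanLength K γ := by
  refine csInf_le ⟨0, ?_⟩ ⟨γ, rfl, rfl, hX, hγ, rfl⟩
  rintro _ ⟨γ, -, -, -, -, rfl⟩
  exact bergmanLength_nonneg K γ

theorem deriv_comp_affine {n : ℕ} (γ : ℝ → (Fin n → ℂ)) (a c t : ℝ) :
    deriv (fun t => γ (a + c * t)) t = c • deriv γ (a + c * t) := by
  have := deriv_comp_mul_left c (fun x => γ (a + x)) t
  rw [this, deriv_comp_const_add]

theorem PiecewiseC1.comp_affine {n : ℕ} {γ : ℝ → (Fin n → ℂ)} (hγ : PiecewiseC1 γ) {a b : ℝ}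
    (ha : a ∈ Icc (0 : ℝ) 1) (hb : b ∈ Icc (0 : ℝ) 1) :
    PiecewiseC1 fun t => γ (a + (b - a) * t) := by
  rw [piecewiseC1_iff] at hγ ⊢
  obtain ⟨hc, F, hF⟩ := hγ
  have hm : MapsTo (fun t => a + (b - a) * t) (Icc 0 1) (Icc (0 : ℝ) 1) := by
    rintro t ⟨h0, h1⟩
    obtain ⟨ha0, ha1⟩ := ha
    obtain ⟨hb0, hb1⟩ := hb
    constructor <;> nlinarith
  refine ⟨hc.comp (by fun_prop) hm, F.image fun x => (x - a) / (b - a), ?_⟩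
  intro u v hu huv hv huvF
  rcases lt_trichotomy a b with hab | rfl | hab
  · have hp : 0 < b - a := sub_pos.2 hab
    refine (hF (a + (b - a) * u) (a + (b - a) * v) (hm ⟨hu, by linarith⟩).1 (by gcongr)
      (hm ⟨by linarith, hv⟩).2 ?_).comp (by fun_prop) ?_
    · intro x hx hxI
      refine huvF _ (Finset.mem_image_of_mem _ hx) ⟨?_, ?_⟩
      · rw [lt_div_iff₀ hp]; linarith [hxI.1]
      · rw [div_lt_iff₀ hp]; linarith [hxI.2]
    · rintro t ⟨h1, h2⟩
      constructor <;> nlinarith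
  · simpa using contDiffOn_const
  · have hp : b - a < 0 := sub_neg.2 hab
    have hlt : a + (b - a) * v < a + (b - a) * u := by nlinarith
    refine (hF (a + (b - a) * v) (a + (b - a) * u) (hm ⟨by linarith, hv⟩).1 hlt
      (hm ⟨hu, by linarith⟩).2 ?_).comp (by fun_prop) ?_
    · intro x hx hxI
      refine huvF _ (Finset.mem_image_of_mem _ hx) ⟨?_, ?_⟩
      · rw [lt_div_iff_of_neg hp]; linarith [hxI.2]
      · rw [div_lt_iff_of_neg hp]; linarith [hxI.1]
    · rintro t ⟨h1, h2⟩
      constructor <;> nlinarith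

theorem bergmanLength_comp_affine {n : ℕ} (K : (Fin n → ℂ) → (Fin n → ℂ) → ℂ)
    (γ : ℝ → (Fin n → ℂ)) (a b : ℝ) :
    bergmanLength K (fun t => γ (a + (b - a) * t)) =
      |∫ t in a..b, bergmanMetric K (γ t) (deriv γ t)| := by
  have h := intervalIntegral.smul_integral_comp_add_mul (a := 0) (b := 1)
    (fun t => bergmanMetric K (γ t) (deriv γ t)) (b - a) a
  simp only [mul_zero, add_zero, mul_one, add_sub_cancel, smul_eq_mul] at h
  rw [← h, abs_mul, abs_of_nonneg (a := ∫ _ in (0 : ℝ)..1, _)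
    (intervalIntegral.integral_nonneg zero_le_one fun _ _ => bergmanMetric_nonneg ..),
    ← intervalIntegral.integral_const_mul]
  simp only [bergmanLength, deriv_comp_affine, bergmanMetric_smul]

/-- The distance between two points of a curve is at most the length of the arc between them. -/
theorem bergmanDist_le_arc {n : ℕ} {X : Set (Fin n → ℂ)} {K : (Fin n → ℂ) → (Fin n → ℂ) → ℂ}
    {γ : ℝ → (Fin n → ℂ)} (hγ : PiecewiseC1 γ) (hX : ∀ t ∈ Icc (0 : ℝ) 1, γ t ∈ X) {a b : ℝ}
    (ha : a ∈ Icc (0 : ℝ) 1) (hb : b ∈ Icc (0 : ℝ) 1) :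
    bergmanDist X K (γ a) (γ b) ≤ |∫ t in a..b, bergmanMetric K (γ t) (deriv γ t)| := by
  rw [← bergmanLength_comp_affine]
  have := bergmanDist_le_length (K := K) (hγ.comp_affine ha hb) (X := X) ?_
  · simpa using this
  · rintro t ⟨h0, h1⟩
    refine hX _ ?_
    obtain ⟨ha0, ha1⟩ := ha
    obtain ⟨hb0, hb1⟩ := hb
    constructor <;> nlinarith

theorem bergmanDist_self {n : ℕ} {X : Set (Fin n → ℂ)} (K : (Fin n → ℂ) → (Fin n → ℂ) → ℂ)
    {x : Fin n → ℂ} (hx : x ∈ X) : bergmanDist X K x x = 0 := by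
  have hc : PiecewiseC1 fun _ : ℝ => x :=
    (piecewiseC1_iff _).2 ⟨continuousOn_const, ∅, fun _ _ _ _ _ _ => contDiffOn_const⟩
  refine le_antisymm ?_ (bergmanDist_nonneg ..)
  simpa using bergmanDist_le_arc (K := K) hc (fun _ _ => hx) (a := 0) (b := 0) (by simp) (by simp)

/-- Since the Bochner integral of a non-integrable function is zero, a curve joining two points at
positive distance has an integrable length density. -/
theorem BergmanDistIsDistance.intervalIntegrable {n : ℕ} {X : Set (Fin n → ℂ)}
    {K : (Fin n → ℂ) → (Fin n → ℂ) → ℂ} (hdist : BergmanDistIsDistance X K)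
    {γ : ℝ → (Fin n → ℂ)} (hγ : PiecewiseC1 γ) (hX : ∀ t ∈ Icc (0 : ℝ) 1, γ t ∈ X)
    (hne : γ 0 ≠ γ 1) :
    IntervalIntegrable (fun t => bergmanMetric K (γ t) (deriv γ t)) volume 0 1 := by
  by_contra h
  have h1 := hdist _ (hX 0 (by simp)) _ (hX 1 (by simp)) hne
  have h2 := bergmanDist_le_length (K := K) hγ hX
  rw [bergmanLength, intervalIntegral.integral_undef h] at h2
  linarith

theorem BergmanDistIsDistance.exists_curve {n : ℕ} {X : Set (Fin n → ℂ)}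
    {K : (Fin n → ℂ) → (Fin n → ℂ) → ℂ} (hdist : BergmanDistIsDistance X K) {x y : Fin n → ℂ}
    (hx : x ∈ X) (hy : y ∈ X) (hne : x ≠ y) {c : ℝ} (hc : bergmanDist X K x y < c) :
    ∃ γ : ℝ → (Fin n → ℂ), γ 0 = x ∧ γ 1 = y ∧ (∀ t ∈ Icc (0 : ℝ) 1, γ t ∈ X) ∧
      PiecewiseC1 γ ∧ bergmanLength K γ < c := by
  have hpos := hdist x hx y hy hne
  obtain ⟨_, ⟨γ, h0, h1, hX, hγ, rfl⟩, hlt⟩ := exists_lt_of_csInf_lt (by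
    rw [nonempty_iff_ne_empty]
    intro he
    rw [bergmanDist, he, Real.sInf_empty] at hpos
    exact lt_irrefl _ hpos) hc
  exact ⟨γ, h0, h1, hX, hγ, hlt⟩

/-- Concatenation of two curves parametrized by `[0,1]`. -/
def concatCurve {n : ℕ} (γ₁ γ₂ : ℝ → (Fin n → ℂ)) (t : ℝ) : Fin n → ℂ :=
  if t ≤ 1 / 2 then γ₁ (0 + 2 * t) else γ₂ (-1 + 2 * t)

theorem concatCurve_of_le {n : ℕ} (γ₁ γ₂ : ℝ → (Fin n → ℂ)) {t : ℝ} (ht : t ≤ 1 / 2) :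
    concatCurve γ₁ γ₂ t = γ₁ (0 + 2 * t) := if_pos ht

theorem concatCurve_of_ge {n : ℕ} {γ₁ γ₂ : ℝ → (Fin n → ℂ)} (h : γ₁ 1 = γ₂ 0) {t : ℝ}
    (ht : 1 / 2 ≤ t) : concatCurve γ₁ γ₂ t = γ₂ (-1 + 2 * t) := by
  rcases ht.eq_or_lt with rfl | ht
  · rw [concatCurve_of_le _ _ le_rfl]
    norm_num [h]
  · exact if_neg (not_le.2 ht)

theorem PiecewiseC1.concatCurve {n : ℕ} {γ₁ γ₂ : ℝ → (Fin n → ℂ)} (h₁ : PiecewiseC1 γ₁)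
    (h₂ : PiecewiseC1 γ₂) (h : γ₁ 1 = γ₂ 0) : PiecewiseC1 (concatCurve γ₁ γ₂) := by
  rw [piecewiseC1_iff] at h₁ h₂ ⊢
  obtain ⟨hc₁, F₁, hF₁⟩ := h₁
  obtain ⟨hc₂, F₂, hF₂⟩ := h₂
  refine ⟨?_, insert (1 / 2) (F₁.image (· / 2) ∪ F₂.image fun x => (x + 1) / 2), ?_⟩
  · rw [← Icc_union_Icc_eq_Icc (b := (1 / 2 : ℝ)) (by norm_num) (by norm_num)]
    refine ContinuousOn.union_of_isClosed ?_ ?_ isClosed_Icc isClosed_Icc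
    · refine (hc₁.comp (f := fun t => 0 + 2 * t) (by fun_prop) ?_).congr fun t ht =>
        concatCurve_of_le _ _ ht.2
      rintro t ⟨h0, h1⟩
      constructor <;> linarith
    · refine (hc₂.comp (f := fun t => -1 + 2 * t) (by fun_prop) ?_).congr fun t ht =>
        concatCurve_of_ge h ht.1
      rintro t ⟨h0, h1⟩
      constructor <;> linarith
  · intro a b ha hab hb hF
    rcases le_or_gt b (1 / 2) with hb2 | hb2
    · refine ((hF₁ (0 + 2 * a) (0 + 2 * b) (by linarith) (by linarith) (by linarith) ?_).comp
        (f := fun t => 0 + 2 * t) (by fun_prop) ?_).congr fun t ht =>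
        concatCurve_of_le _ _ (ht.2.trans hb2)
      · intro x hx hxI
        refine hF (x / 2) (by simp only [Finset.mem_insert, Finset.mem_union, Finset.mem_image]
                              exact .inr (.inl ⟨x, hx, rfl⟩)) ⟨?_, ?_⟩ <;>
          linarith [hxI.1, hxI.2]
      · rintro t ⟨h0, h1⟩
        constructor <;> linarith
    · have ha2 : 1 / 2 ≤ a := by
        by_contra! h
        exact hF (1 / 2) (by simp) ⟨h, hb2⟩
      refine ((hF₂ (-1 + 2 * a) (-1 + 2 * b) (by linarith) (by linarith) (by linarith) ?_).comp
        (f := fun t => -1 + 2 * t) (by fun_prop) ?_).congr fun t ht =>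
        concatCurve_of_ge h (ha2.trans ht.1)
      · intro x hx hxI
        refine hF ((x + 1) / 2) (by simp only [Finset.mem_insert, Finset.mem_union, Finset.mem_image]
                                    exact .inr (.inr ⟨x, hx, rfl⟩)) ⟨?_, ?_⟩ <;>
          linarith [hxI.1, hxI.2]
      · rintro t ⟨h0, h1⟩
        constructor <;> linarith

theorem integral_bergmanMetric_of_eqOn {n : ℕ} (K : (Fin n → ℂ) → (Fin n → ℂ) → ℂ)
    {η γ : ℝ → (Fin n → ℂ)} {u v a : ℝ} (huv : u ≤ v)
    (h : ∀ t ∈ Ioo u v, η t = γ (a + 2 * t)) :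
    ∫ t in u..v, bergmanMetric K (η t) (deriv η t) =
      ∫ t in (a + 2 * u)..(a + 2 * v), bergmanMetric K (γ t) (deriv γ t) := by
  rw [← intervalIntegral.smul_integral_comp_add_mul, smul_eq_mul,
    ← intervalIntegral.integral_const_mul, intervalIntegral.integral_of_le huv,
    intervalIntegral.integral_of_le huv, integral_Ioc_eq_integral_Ioo,
    integral_Ioc_eq_integral_Ioo]
  refine setIntegral_congr_fun measurableSet_Ioo fun t ht => ?_
  have he : η =ᶠ[𝓝 t] fun t => γ (a + 2 * t) := by
    filter_upwards [Ioo_mem_nhds ht.1 ht.2] with s hs using h s hs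
  simp only [he.deriv_eq, h t ht, deriv_comp_affine, bergmanMetric_smul, abs_two]

theorem BergmanDistIsDistance.triangle {n : ℕ} {X : Set (Fin n → ℂ)}
    {K : (Fin n → ℂ) → (Fin n → ℂ) → ℂ} (hdist : BergmanDistIsDistance X K) {x y z : Fin n → ℂ}
    (hx : x ∈ X) (hy : y ∈ X) (hz : z ∈ X) :
    bergmanDist X K x z ≤ bergmanDist X K x y + bergmanDist X K y z := by
  rcases eq_or_ne x y with rfl | hxy
  · simp [bergmanDist_self K hx]
  rcases eq_or_ne y z with rfl | hyz
  · simp [bergmanDist_self K hy]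
  rcases eq_or_ne x z with rfl | hxz
  · rw [bergmanDist_self K hx]
    exact add_nonneg (bergmanDist_nonneg ..) (bergmanDist_nonneg ..)
  refine le_of_forall_pos_le_add fun ε hε => ?_
  obtain ⟨γ₁, h10, h11, hX₁, hγ₁, hL₁⟩ :=
    hdist.exists_curve hx hy hxy (lt_add_of_pos_right _ (half_pos hε))
  obtain ⟨γ₂, h20, h21, hX₂, hγ₂, hL₂⟩ :=
    hdist.exists_curve hy hz hyz (lt_add_of_pos_right _ (half_pos hε))
  have h : γ₁ 1 = γ₂ 0 := h11.trans h20.symm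
  have hη := hγ₁.concatCurve hγ₂ h
  have hηX : ∀ t ∈ Icc (0 : ℝ) 1, concatCurve γ₁ γ₂ t ∈ X := by
    rintro t ⟨h0, h1⟩
    rcases le_total t (1 / 2) with ht | ht
    · rw [concatCurve_of_le _ _ ht]
      exact hX₁ _ ⟨by linarith, by linarith⟩
    · rw [concatCurve_of_ge h ht]
      exact hX₂ _ ⟨by linarith, by linarith⟩
  have hη0 : concatCurve γ₁ γ₂ 0 = x := by
    rw [concatCurve_of_le _ _ (by norm_num)]
    simpa using h10
  have hη1 : concatCurve γ₁ γ₂ 1 = z := by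
    rw [concatCurve_of_ge h (by norm_num)]
    norm_num [h21]
  have hint := hdist.intervalIntegrable hη hηX (by rwa [hη0, hη1])
  have hle := bergmanDist_le_length (K := K) hη hηX
  have hhalf : (1 / 2 : ℝ) ∈ uIcc (0 : ℝ) 1 := by
    rw [uIcc_of_le zero_le_one]; norm_num
  rw [hη0, hη1, bergmanLength, ← intervalIntegral.integral_add_adjacent_intervals
    (hint.mono_set (uIcc_subset_uIcc_left hhalf)) (hint.mono_set (uIcc_subset_uIcc_right hhalf)),
    integral_bergmanMetric_of_eqOn K (γ := γ₁) (a := 0) (by norm_num)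
      (fun t ht => concatCurve_of_le _ _ ht.2.le),
    integral_bergmanMetric_of_eqOn K (γ := γ₂) (a := -1) (by norm_num)
      (fun t ht => concatCurve_of_ge h ht.1.le)] at hle
  norm_num at hle
  unfold bergmanLength at hL₁ hL₂
  linarith

/-- Any sequence converging fast enough to `p` lies, along points tending to `0`, on a `C¹` curve
starting at `p` that stays close to `p`. -/
theorem exists_contDiff_through {n : ℕ} (p : Fin n → ℂ) {δ : ℝ} (q : ℕ → (Fin n → ℂ))
    (hq : ∀ k, ‖q k - p‖ ≤ δ * (1 / 8) ^ k) :
    ∃ σ : ℝ → (Fin n → ℂ), ContDiff ℝ 1 σ ∧ σ 0 = p ∧ (∀ k, σ ((1 / 4) ^ k) = q k) ∧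
      ∀ t, ‖σ t - p‖ ≤ δ * 2 := by
  have hδ : 0 ≤ δ := by simpa using (norm_nonneg _).trans (hq 0)
  let ψ : ContDiffBump (0 : ℝ) := ⟨1 / 4, 1 / 2, by norm_num, by norm_num⟩
  have hψs : ContDiff ℝ 1 ψ := ψ.contDiff
  have hψ0 : ψ 0 = 1 := ψ.one_of_mem_closedBall (by simp [ψ.rIn_pos.le])
  have hψz : ∀ s : ℝ, 1 / 2 ≤ |s| → ψ s = 0 := fun s hs =>
    ψ.zero_of_le_dist (by rwa [Real.dist_eq, sub_zero])
  obtain ⟨C, hC⟩ : ∃ C, ∀ s, ‖deriv ψ s‖ ≤ C :=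
    (hψs.continuous_deriv le_rfl).bounded_above_of_compact_support ψ.hasCompactSupport.deriv
  have hC0 : 0 ≤ C := (norm_nonneg _).trans (hC 0)
  let f : ℕ → ℝ → (Fin n → ℂ) := fun k t => ψ (4 ^ k * t - 1) • (q k - p)
  have hfs : ∀ k, ContDiff ℝ 1 (f k) := fun k =>
    (hψs.comp (by fun_prop : ContDiff ℝ 1 fun t : ℝ => 4 ^ k * t - 1)).smul contDiff_const
  have hf0 : ∀ k t, ‖f k t‖ ≤ δ * (1 / 2) ^ k := fun k t => by
    rw [norm_smul, Real.norm_of_nonneg ψ.nonneg]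
    calc _ ≤ 1 * (δ * (1 / 8) ^ k) :=
          mul_le_mul ψ.le_one (hq k) (norm_nonneg _) zero_le_one
      _ ≤ _ := by rw [one_mul]; gcongr; norm_num
  have hf1 : ∀ k t, ‖deriv (f k) t‖ ≤ C * δ * (1 / 2) ^ k := fun k t => by
    have h1 : HasDerivAt (fun t : ℝ => 4 ^ k * t - 1) (4 ^ k) t := by
      simpa using ((hasDerivAt_id t).const_mul ((4 : ℝ) ^ k)).sub_const 1
    have h2 : HasDerivAt ψ (deriv ψ (4 ^ k * t - 1)) (4 ^ k * t - 1) :=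
      ((hψs.differentiable one_ne_zero) _).hasDerivAt
    have h3 : HasDerivAt (f k) ((deriv ψ (4 ^ k * t - 1) * 4 ^ k) • (q k - p)) t :=
      (h2.comp t h1).smul_const (q k - p)
    rw [h3.deriv, norm_smul, norm_mul, norm_pow]
    calc _ ≤ (C * ‖(4 : ℝ)‖ ^ k) * (δ * (1 / 8) ^ k) := by
          gcongr
          · exact hC _
          · exact hq k
      _ = C * δ * (1 / 2) ^ k := by
        rw [Real.norm_of_nonneg (by norm_num), show (1 / 2 : ℝ) = 4 * (1 / 8) by norm_num,
          mul_pow]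
        ring
  have hgeo : Summable fun k : ℕ => (1 / 2 : ℝ) ^ k := summable_geometric_two
  have hσ : ContDiff ℝ 1 fun t => ∑' k, f k t := by
    refine contDiff_tsum (N := 1) (v := fun m k => (if m = 0 then δ else C * δ) * (1 / 2) ^ k)
      hfs (fun m _ => hgeo.mul_left _) fun m k t hm => ?_
    have hm : m ≤ 1 := by exact_mod_cast hm
    interval_cases m
    · simpa using hf0 k t
    · rw [norm_iteratedFDeriv_one, ← norm_deriv_eq_norm_fderiv]
      simpa using hf1 k t
  refine ⟨fun t => p + ∑' k, f k t, contDiff_const.add hσ, ?_, fun k => ?_, fun t => ?_⟩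
  · have : ∀ k, f k 0 = 0 := fun k => by
      simp [f, hψz (-1) (by norm_num)]
    simp [this]
  · have h1 : ∑' j, f j ((1 / 4) ^ k) = f k ((1 / 4) ^ k) := by
      refine tsum_eq_single k fun j hj => ?_
      simp only [f]
      rw [hψz, zero_smul]
      rcases lt_or_gt_of_ne hj with h | h
      · obtain ⟨m, rfl⟩ := Nat.exists_eq_add_of_lt h
        have : (4 : ℝ) ^ j * (1 / 4) ^ (j + m + 1) = (1 / 4) * (1 / 4) ^ m := by
          rw [pow_succ, pow_add, ← mul_assoc, ← mul_assoc, ← mul_pow]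
          norm_num
          ring
        rw [this]
        have h4 : ((1 : ℝ) / 4) ^ m ≤ 1 := pow_le_one₀ (by norm_num) (by norm_num)
        rw [abs_of_nonpos (by linarith)]
        linarith
      · obtain ⟨m, rfl⟩ := Nat.exists_eq_add_of_lt h
        have : (4 : ℝ) ^ (k + m + 1) * (1 / 4) ^ k = 4 * 4 ^ m := by
          rw [show (4 : ℝ) ^ (k + m + 1) * (1 / 4) ^ k = (4 ^ k * (1 / 4) ^ k) * (4 * 4 ^ m) by ring,
            ← mul_pow]
          norm_num
        rw [this]
        have h4 : 1 ≤ (4 : ℝ) ^ m := one_le_pow₀ (by norm_num)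
        rw [abs_of_nonneg (by linarith)]
        linarith
    dsimp only
    rw [h1]
    simp [f, hψ0]
  · rw [add_sub_cancel_left]
    exact tsum_of_norm_bounded (hasSum_geometric_two.mul_left δ) fun k => hf0 k t

theorem ContDiff.piecewiseC1 {n : ℕ} {σ : ℝ → (Fin n → ℂ)} (hσ : ContDiff ℝ 1 σ) :
    PiecewiseC1 σ :=
  (piecewiseC1_iff _).2 ⟨hσ.continuous.continuousOn, ∅, fun _ _ _ _ _ _ => hσ.contDiffOn⟩

/-- The Bergman distance is small near the diagonal. Otherwise there would be a fast converging
sequence `q k → p` at distance bounded below from `p`; but a `C¹` curve from `p` through all `q k`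
has an integrable length density, so its initial arcs have arbitrarily small length. -/
theorem BergmanDistIsDistance.eventually_lt {n : ℕ} {X : Set (Fin n → ℂ)} (hX : IsOpen X)
    {K : (Fin n → ℂ) → (Fin n → ℂ) → ℂ} (hdist : BergmanDistIsDistance X K) {p : Fin n → ℂ}
    (hp : p ∈ X) {ε : ℝ} (hε : 0 < ε) :
    ∀ᶠ q in 𝓝 p, bergmanDist X K p q < ε ∧ bergmanDist X K q p < ε := by
  obtain ⟨r, hr, hrX⟩ := Metric.isOpen_iff.1 hX p hp
  by_contra hcon
  have hex : ∀ k : ℕ, ∃ q, ‖q - p‖ ≤ r / 4 * (1 / 8) ^ k ∧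
      ¬ (bergmanDist X K p q < ε ∧ bergmanDist X K q p < ε) := fun k => by
    by_contra! h
    refine hcon ?_
    filter_upwards [Metric.closedBall_mem_nhds p (show 0 < r / 4 * (1 / 8) ^ k by positivity)]
      with q hq using h q (by simpa [dist_eq_norm] using hq)
  choose q hq hnot using hex
  obtain ⟨σ, hσ, hσ0, hσq, hσr⟩ := exists_contDiff_through p q hq
  have hσX : ∀ t ∈ Icc (0 : ℝ) 1, σ t ∈ X := fun t _ =>
    hrX (by rw [mem_ball, dist_eq_norm]; linarith [hσr t])
  have hσ1 : σ 1 = q 0 := by simpa using hσq 0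
  have hne : σ 0 ≠ σ 1 := by
    rw [hσ0, hσ1]
    intro h
    refine hnot 0 ?_
    rw [← h, bergmanDist_self K hp]
    exact ⟨hε, hε⟩
  have hint := hdist.intervalIntegrable hσ.piecewiseC1 hσX hne
  have hcont := intervalIntegral.continuousOn_primitive_interval' hint left_mem_uIcc
  have hI : ∀ k : ℕ, ((1 : ℝ) / 4) ^ k ∈ Icc (0 : ℝ) 1 := fun k =>
    ⟨by positivity, pow_le_one₀ (by norm_num) (by norm_num)⟩
  have hlim : Tendsto (fun k : ℕ => ((1 : ℝ) / 4) ^ k) atTop (𝓝[uIcc 0 1] 0) := by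
    refine tendsto_nhdsWithin_iff.2 ⟨tendsto_pow_atTop_nhds_zero_of_lt_one (by norm_num)
      (by norm_num), .of_forall fun k => ?_⟩
    rw [uIcc_of_le zero_le_one]
    exact hI k
  have ht := (hcont 0 left_mem_uIcc).tendsto.comp hlim
  simp only [intervalIntegral.integral_same] at ht
  obtain ⟨k, hk⟩ := (ht.abs.eventually (gt_mem_nhds (by simpa using hε))).exists
  refine hnot k ⟨?_, ?_⟩
  · have := bergmanDist_le_arc (K := K) hσ.piecewiseC1 hσX (a := 0) (by simp) (hI k)
    rw [hσ0, hσq] at this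
    exact this.trans_lt hk
  · have := bergmanDist_le_arc (K := K) hσ.piecewiseC1 hσX (b := 0) (hI k) (by simp)
    rw [hσ0, hσq, intervalIntegral.integral_symm, abs_neg] at this
    exact this.trans_lt hk

/-- Small Bergman balls are contained in small polydiscs. -/
theorem BergmanDistIsDistance.exists_bergmanBall_subset {n : ℕ} {X : Set (Fin n → ℂ)}
    (hX : IsOpen X) {K : (Fin n → ℂ) → (Fin n → ℂ) → ℂ} (hdist : BergmanDistIsDistance X K)
    {p : Fin n → ℂ} (hp : p ∈ X) {ε : ℝ} (hε : 0 < ε) (hεX : closedBall p ε ⊆ X) :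
    ∃ m : ℝ, 0 < m ∧ bergmanBall X K p m ⊆ ball p ε := by
  obtain ⟨m, hm, hms⟩ : ∃ m : ℝ, 0 < m ∧ ∀ s ∈ sphere p ε, m ≤ bergmanDist X K p s := by
    refine (isCompact_sphere p ε).induction_on (p := fun S => ∃ m : ℝ, 0 < m ∧
      ∀ s ∈ S, m ≤ bergmanDist X K p s) ⟨1, one_pos, by simp⟩ ?_ ?_ ?_
    · rintro S T hST ⟨m, hm, h⟩
      exact ⟨m, hm, fun s hs => h s (hST hs)⟩
    · rintro S T ⟨m₁, hm₁, h₁⟩ ⟨m₂, hm₂, h₂⟩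
      refine ⟨min m₁ m₂, lt_min hm₁ hm₂, ?_⟩
      rintro s (hs | hs)
      · exact (min_le_left ..).trans (h₁ s hs)
      · exact (min_le_right ..).trans (h₂ s hs)
    · intro s hs
      have hsX : s ∈ X := hεX (sphere_subset_closedBall hs)
      have hpos := hdist p hp s hsX (ne_of_mem_sphere hs hε.ne').symm
      refine ⟨{q | q ∈ X ∧ bergmanDist X K q s < bergmanDist X K p s / 2}, ?_,
        bergmanDist X K p s / 2, half_pos hpos, ?_⟩
      · refine mem_nhdsWithin_of_mem_nhds ?_
        filter_upwards [hX.mem_nhds hsX, hdist.eventually_lt hX hsX (half_pos hpos)] with q h1 h2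
        exact ⟨h1, h2.2⟩
      · rintro q ⟨hqX, hq⟩
        linarith [hdist.triangle hp hqX hsX]
  refine ⟨m, hm, ?_⟩
  rintro z ⟨hzX, hz⟩
  by_contra hzb
  have hne : p ≠ z := by
    rintro rfl
    exact hzb (mem_ball_self hε)
  obtain ⟨γ, h0, h1, hγX, hγ, hL⟩ := hdist.exists_curve hp hzX hne hz
  have hcont : ContinuousOn (fun t => dist (γ t) p) (Icc 0 1) :=
    continuous_dist.comp_continuousOn (ContinuousOn.prodMk hγ.1 continuousOn_const)
  obtain ⟨τ, hτ, hτs⟩ := intermediate_value_Icc zero_le_one hcont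
    (show ε ∈ Icc (dist (γ 0) p) (dist (γ 1) p) by
      rw [h0, h1, dist_self]
      exact ⟨hε.le, not_lt.1 hzb⟩)
  have hint := hdist.intervalIntegrable hγ hγX (by rwa [h0, h1])
  have hle := bergmanDist_le_arc (K := K) hγ hγX (a := 0) (by simp) hτ
  rw [h0, abs_of_nonneg (intervalIntegral.integral_nonneg hτ.1 fun _ _ =>
    bergmanMetric_nonneg ..)] at hle
  have hmono := intervalIntegral.integral_mono_interval (le_refl 0) hτ.1 hτ.2
    (.of_forall fun _ => bergmanMetric_nonneg ..) hint
  have := hms (γ τ) hτs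
  unfold bergmanLength at hL
  linarith

/-- The radii of Bergman balls around `p` that fit in a biholomorphic image of the unit ball. -/
def fridmanRadii {n : ℕ} (X : Set (Fin n → ℂ)) (K : (Fin n → ℂ) → (Fin n → ℂ) → ℂ)
    (p : Fin n → ℂ) : Set ℝ :=
  { r : ℝ | 0 < r ∧ ∃ f : (Fin n → ℂ) → (Fin n → ℂ),
    DifferentiableOn ℂ f (euclUnitBall n) ∧ Set.InjOn f (euclUnitBall n) ∧
    f '' euclUnitBall n ⊆ X ∧ bergmanBall X K p r ⊆ f '' euclUnitBall n }

theorem fridmanInv_le {n : ℕ} {X : Set (Fin n → ℂ)} {K : (Fin n → ℂ) → (Fin n → ℂ) → ℂ}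
    {p : Fin n → ℂ} {r : ℝ} (hr : r ∈ fridmanRadii X K p) : fridmanInv X K p ≤ 1 / r := by
  refine csInf_le ⟨0, ?_⟩ ⟨r, hr.1, rfl, hr.2⟩
  rintro _ ⟨r, hr, rfl, -⟩
  positivity

theorem fridmanInv_nonneg {n : ℕ} (X : Set (Fin n → ℂ)) (K : (Fin n → ℂ) → (Fin n → ℂ) → ℂ)
    (p : Fin n → ℂ) : 0 ≤ fridmanInv X K p := by
  refine Real.sInf_nonneg ?_
  rintro _ ⟨r, hr, rfl, -⟩
  positivity

theorem exists_one_div_lt_of_fridmanInv_lt {n : ℕ} {X : Set (Fin n → ℂ)}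
    {K : (Fin n → ℂ) → (Fin n → ℂ) → ℂ} {p : Fin n → ℂ} (hne : (fridmanRadii X K p).Nonempty)
    {c : ℝ} (hc : fridmanInv X K p < c) : ∃ r ∈ fridmanRadii X K p, 1 / r < c := by
  obtain ⟨r₀, hr₀⟩ := hne
  obtain ⟨_, ⟨r, hr, rfl, hf⟩, hlt⟩ := exists_lt_of_csInf_lt (by
    exact ⟨_, r₀, hr₀.1, rfl, hr₀.2⟩) hc
  exact ⟨r, ⟨hr, hf⟩, hlt⟩

theorem BergmanDistIsDistance.fridmanRadii_nonempty {n : ℕ} {X : Set (Fin n → ℂ)}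
    (hX : IsOpen X) {K : (Fin n → ℂ) → (Fin n → ℂ) → ℂ} (hdist : BergmanDistIsDistance X K)
    {p : Fin n → ℂ} (hp : p ∈ X) : (fridmanRadii X K p).Nonempty := by
  obtain ⟨ε, hε, hεX⟩ := Metric.nhds_basis_closedBall.mem_iff.1 (hX.mem_nhds hp)
  have hn : (0 : ℝ) < n + 1 := by positivity
  have hdiv : ε / (n + 1) ≤ ε := div_le_self hε.le (by linarith [n.cast_nonneg (α := ℝ)])
  obtain ⟨m, hm, hmb⟩ := hdist.exists_bergmanBall_subset hX hp (div_pos hε hn)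
    ((closedBall_subset_closedBall hdiv).trans hεX)
  have hεC : (ε : ℂ) ≠ 0 := by exact_mod_cast hε.ne'
  refine ⟨m, hm, fun z => p + (ε : ℂ) • z, by fun_prop, ?_, ?_, hmb.trans ?_⟩
  · intro z _ w _ h
    exact smul_right_injective _ hεC (add_left_cancel h)
  · rintro _ ⟨z, hz, rfl⟩
    refine hεX ?_
    rw [mem_closedBall, dist_eq_norm, add_sub_cancel_left, norm_smul, Complex.norm_real,
      Real.norm_of_nonneg hε.le]
    refine mul_le_of_le_one_right hε.le ((pi_norm_le_iff_of_nonneg zero_le_one).2 fun i => ?_)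
    have h1 : ‖z i‖ ^ 2 ≤ ∑ μ, ‖z μ‖ ^ 2 :=
      Finset.single_le_sum (f := fun μ => ‖z μ‖ ^ 2) (fun _ _ => sq_nonneg _)
        (Finset.mem_univ i)
    have h2 : ∑ μ, ‖z μ‖ ^ 2 < 1 := hz
    exact (sq_le_one_iff₀ (norm_nonneg _)).1 (h1.trans h2.le)
  · intro w hw
    refine ⟨(ε : ℂ)⁻¹ • (w - p), ?_, by simp [smul_inv_smul₀ hεC]⟩
    have hz : ∀ i, ‖((ε : ℂ)⁻¹ • (w - p)) i‖ ≤ 1 / (n + 1) := fun i => by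
      refine (norm_le_pi_norm _ i).trans ?_
      rw [norm_smul, norm_inv, Complex.norm_real, Real.norm_of_nonneg hε.le, ← dist_eq_norm,
        inv_mul_le_iff₀ hε, mul_one_div]
      exact (mem_ball.1 hw).le
    calc ∑ μ, ‖((ε : ℂ)⁻¹ • (w - p)) μ‖ ^ 2 ≤ ∑ _μ : Fin n, (1 / ((n : ℝ) + 1)) ^ 2 :=
          Finset.sum_le_sum fun i _ => pow_le_pow_left₀ (norm_nonneg _) (hz i) 2
      _ = n / ((n : ℝ) + 1) ^ 2 := by simp [div_eq_mul_inv]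
      _ < 1 := by
        rw [div_lt_one (by positivity)]
        nlinarith [n.cast_nonneg (α := ℝ)]

theorem BergmanDistIsDistance.sub_mem_fridmanRadii {n : ℕ} {X : Set (Fin n → ℂ)}
    {K : (Fin n → ℂ) → (Fin n → ℂ) → ℂ} (hdist : BergmanDistIsDistance X K) {p q : Fin n → ℂ}
    (hp : p ∈ X) (hq : q ∈ X) {r δ : ℝ} (hr : r ∈ fridmanRadii X K p)
    (hδ : bergmanDist X K p q < δ) (hδr : δ < r) : r - δ ∈ fridmanRadii X K q := by
  obtain ⟨-, f, hf, hinj, hfX, hB⟩ := hr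
  refine ⟨sub_pos.2 hδr, f, hf, hinj, hfX, fun z hz => hB ⟨hz.1, ?_⟩⟩
  linarith [hdist.triangle hp hq hz.1, hz.2]

/-- the Bergman–Fridman invariant function is continuous on `X`. -/
theorem fridman_continuousOn {n : ℕ} (X : Set (Fin n → ℂ))
    (hXopen : IsOpen X) (hXconn : IsConnected X)
    (K : (Fin n → ℂ) → (Fin n → ℂ) → ℂ) (hK : IsBergmanKernel X K)
    (hdist : BergmanDistIsDistance X K) :
    ContinuousOn (fridmanInv X K) X := by
  intro p hp
  refine ContinuousAt.continuousWithinAt ?_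
  refine tendsto_order.2 ⟨fun c hc => ?_, fun c hc => ?_⟩
  · rcases lt_or_ge c 0 with hc0 | hc0
    · exact .of_forall fun q => hc0.trans_le (fridmanInv_nonneg ..)
    obtain ⟨c', hcc', hc'⟩ := exists_between hc
    have hc'0 : 0 < c' := hc0.trans_lt hcc'
    have hH : 0 < fridmanInv X K p := hc'0.trans hc'
    have hδ : 0 < 1 / c' - 1 / fridmanInv X K p := sub_pos.2 (one_div_lt_one_div_of_lt hc'0 hc')
    filter_upwards [hXopen.mem_nhds hp, hdist.eventually_lt hXopen hp hδ] with q hq hpq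
    refine hcc'.trans_le (le_of_not_gt fun hlt => ?_)
    obtain ⟨r, hr, hrc⟩ :=
      exists_one_div_lt_of_fridmanInv_lt (hdist.fridmanRadii_nonempty hXopen hq) hlt
    have hrc' : 1 / c' < r := (one_div_lt hr.1 hc'0).1 hrc
    have hinv : 0 < 1 / fridmanInv X K p := one_div_pos.2 hH
    have hmem := hdist.sub_mem_fridmanRadii hq hp hr hpq.2 (by linarith)
    have hle := fridmanInv_le hmem
    rw [le_one_div hH hmem.1] at hle
    linarith
  · obtain ⟨r, hr, hrc⟩ :=
      exists_one_div_lt_of_fridmanInv_lt (hdist.fridmanRadii_nonempty hXopen hp) hc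
    have hc0 : 0 < c := (one_div_pos.2 hr.1).trans hrc
    have hrc' : 1 / c < r := (one_div_lt hr.1 hc0).1 hrc
    have hinv : 0 < 1 / c := one_div_pos.2 hc0
    have hδ : 0 < (r - 1 / c) / 2 := by linarith
    filter_upwards [hXopen.mem_nhds hp, hdist.eventually_lt hXopen hp hδ] with q hq hpq
    have hmem := hdist.sub_mem_fridmanRadii hp hq hr hpq.1 (by linarith)
    refine (fridmanInv_le hmem).trans_lt ?_
    rw [one_div_lt hmem.1 hc0]
    linarith

end
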